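/- Let S be the Sierpinski gasket with natural measure μ, and for k ≥ 1 let μ_k be the k-th discrete approximation of μ supported on the finite set A_k. Let x ∈ ℝ² and d with 2^{−k} < d ≤ max{‖z₀ − x‖, ‖z₁ − x‖, ‖z₂ − x‖}, and suppose B(x, d) ∩ A_k ≠ ∅. Then there exist points y_k, z_k ∈ A_k such that, writing d_{y_k} = ‖y_k − x‖ and d_{z_k} = ‖z_k − x‖, one has d_{y_k}, d_{z_k} ∈ [d − 2^{−k}, d + 2^{−k}] and μ_k(B̊(x, d_{y_k})) ≤ μ(B(x, d)) ≤ μ_k(B(x, d_{z_k})). -/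

import Mathlib

open MeasureTheory Filter Topology
open scoped ENNReal

noncomputable section

/-- The point `(a, b)` of the Euclidean plane. -/
def pt (a b : ℝ) : EuclideanSpace ℝ (Fin 2) :=
  (WithLp.equiv 2 (Fin 2 → ℝ)).symm ![a, b]

/-- The three contracting similarities generating the Sierpinski gasket. -/
def sierf : Fin 3 → EuclideanSpace ℝ (Fin 2) → EuclideanSpace ℝ (Fin 2) :=
  ![fun v => (1/2 : ℝ) • v,
    fun v => (1/2 : ℝ) • v + pt (1/2) 0,
    fun v => (1/2 : ℝ) • v + pt (1/4) (Real.sqrt 3 / 4)]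

/-- The vertices `z₀, z₁, z₂` of the Sierpinski gasket. -/
def vert : Fin 3 → EuclideanSpace ℝ (Fin 2) :=
  ![pt 0 0, pt 1 0, pt (1/2) (Real.sqrt 3 / 2)]

/-- The composition `f_{i₁} ∘ ⋯ ∘ f_{i_k}` associated with a finite word. -/
def wordMap {X : Type*} {m : ℕ} (f : Fin m → X → X) : List (Fin m) → X → X
  | [] => id
  | j :: l => f j ∘ wordMap f l

/-- The `k`-th discrete approximation
`μ_k = 3^{-k} Σ_{i word of length k-1} Σ_{j} δ_{f_i(z_j)}` of the natural measure. -/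
def muK (k : ℕ) : Measure (EuclideanSpace ℝ (Fin 2)) :=
  ((3 : ℝ≥0∞) ^ k)⁻¹ •
    ∑ w : Fin (k - 1) → Fin 3, ∑ j : Fin 3,
      Measure.dirac (wordMap sierf (List.ofFn w) (vert j))

/-- The finite support `A_k = {f_i(z_j) : i word of length k-1, j ∈ {0,1,2}}` of `μ_k`. -/
def Ak (k : ℕ) : Set (EuclideanSpace ℝ (Fin 2)) :=
  Set.range fun pr : (Fin (k - 1) → Fin 3) × Fin 3 =>
    wordMap sierf (List.ofFn pr.1) (vert pr.2)

lemma sierf_eq (i : Fin 3) (v : EuclideanSpace ℝ (Fin 2)) :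
    sierf i v = (1 / 2 : ℝ) • v + (1 / 2 : ℝ) • vert i := by
  fin_cases i <;> ext j <;> fin_cases j <;> simp [sierf, vert, pt] <;> ring

lemma sierf_vert_self (i : Fin 3) : sierf i (vert i) = vert i := by
  rw [sierf_eq, ← add_smul]
  norm_num

lemma sierf_vert_comm (i j : Fin 3) : sierf i (vert j) = sierf j (vert i) := by
  rw [sierf_eq, sierf_eq, add_comm]

lemma dist_sierf (i : Fin 3) (a b : EuclideanSpace ℝ (Fin 2)) :
    dist (sierf i a) (sierf i b) = 1 / 2 * dist a b := by
  rw [sierf_eq, sierf_eq, dist_add_right, dist_smul₀, Real.norm_of_nonneg (by norm_num)]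

lemma measurable_sierf (i : Fin 3) : Measurable (sierf i) := by
  have : sierf i = fun v => (1 / 2 : ℝ) • v + (1 / 2 : ℝ) • vert i := funext (sierf_eq i)
  rw [this]
  fun_prop

lemma dist_wordMap (w : List (Fin 3)) (a b : EuclideanSpace ℝ (Fin 2)) :
    dist (wordMap sierf w a) (wordMap sierf w b) = ((2 : ℝ) ^ w.length)⁻¹ * dist a b := by
  induction w with
  | nil => simp [wordMap]
  | cons i w ih =>
    simp only [wordMap, Function.comp_apply, dist_sierf, ih, List.length_cons, pow_succ, mul_inv]
    ring

lemma measurable_wordMap (w : List (Fin 3)) : Measurable (wordMap sierf w) := by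
  induction w with
  | nil => exact measurable_id
  | cons i w ih => exact (measurable_sierf i).comp ih

lemma dist_vert_le_one (i j : Fin 3) : dist (vert i) (vert j) ≤ 1 := by
  have h3 : (Real.sqrt 3 / 2) ^ 2 = 3 / 4 := by
    rw [div_pow, Real.sq_sqrt (by norm_num)]; norm_num
  rw [EuclideanSpace.dist_eq, Real.sqrt_le_one]
  fin_cases i <;> fin_cases j <;> simp [vert, pt, Real.dist_eq, Fin.sum_univ_two, h3] <;> norm_num

lemma wordMap_replicate_vert (n : ℕ) (i : Fin 3) :
    wordMap sierf (List.replicate n i) (vert i) = vert i := by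
  induction n with
  | zero => rfl
  | succ n ih => simp [List.replicate_succ, wordMap, ih, sierf_vert_self]

lemma vert_mem_Ak (k : ℕ) (i : Fin 3) : vert i ∈ Ak k :=
  ⟨(fun _ => i, i), by simpa using wordMap_replicate_vert (k - 1) i⟩

/-- The points of the gasket lie within distance one of each vertex. -/
lemma dist_vert_le_one_of_mem {S : Set (EuclideanSpace ℝ (Fin 2))} (hSc : IsCompact S)
    (hSattr : S = ⋃ i, sierf i '' S) {s : EuclideanSpace ℝ (Fin 2)} (hs : s ∈ S) (j : Fin 3) :
    dist s (vert j) ≤ 1 := by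
  obtain ⟨⟨m, i⟩, hm, hmax⟩ := (hSc.prod (isCompact_univ (X := Fin 3))).exists_isMaxOn
    ⟨(s, j), hs, Set.mem_univ _⟩
    (f := fun p : EuclideanSpace ℝ (Fin 2) × Fin 3 => dist p.1 (vert p.2))
    (by
      have : Continuous vert := continuous_of_discreteTopology
      fun_prop)
  have hle : ∀ t ∈ S, ∀ l, dist t (vert l) ≤ dist m (vert i) := fun t ht l =>
    hmax (a := (t, l)) ⟨ht, Set.mem_univ _⟩
  have hmS : m ∈ ⋃ i, sierf i '' S := hSattr ▸ hm.1
  obtain ⟨l, t, ht, rfl⟩ := Set.mem_iUnion.1 hmS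
  have h1 : dist (sierf l t) (sierf l (vert i)) = 1 / 2 * dist t (vert i) := dist_sierf ..
  have h2 : dist (sierf l (vert i)) (vert i) = 1 / 2 * dist (vert l) (vert i) := by
    nth_rw 2 [← sierf_vert_self i]
    rw [sierf_vert_comm, dist_sierf]
  have h3 := dist_triangle (sierf l t) (sierf l (vert i)) (vert i)
  have h4 := dist_vert_le_one l i
  have h5 := hle t ht i
  have h6 := hle s hs j
  linarith

/-- A predicate that is constant on the vertices of each cell of level `n` is constant on the set
of all vertices of cells of level `n`. -/
lemma wordMap_vert_iff (n : ℕ) (p : EuclideanSpace ℝ (Fin 2) → Prop)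
    (hp : ∀ w : List (Fin 3), w.length = n → ∀ i j,
      p (wordMap sierf w (vert i)) → p (wordMap sierf w (vert j)))
    {w v : List (Fin 3)} (hw : w.length = n) (hv : v.length = n) (i j : Fin 3)
    (h : p (wordMap sierf w (vert i))) : p (wordMap sierf v (vert j)) := by
  induction n generalizing p w v i j with
  | zero =>
    obtain rfl := List.length_eq_zero_iff.1 hw
    obtain rfl := List.length_eq_zero_iff.1 hv
    exact hp _ rfl i j h
  | succ n ih =>
    obtain ⟨a, w, rfl⟩ := List.exists_cons_of_length_eq_add_one hw
    obtain ⟨b, v, rfl⟩ := List.exists_cons_of_length_eq_add_one hv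
    have hcell (c : Fin 3) {w v : List (Fin 3)} := ih (fun y => p (sierf c y))
      (fun u hu => hp (c :: u) (by simp [hu])) (w := w) (v := v)
    have h1 : p (sierf a (vert b)) := by
      have := hcell a (by simpa using hw) (List.length_replicate (n := n) (a := b)) i b h
      simpa only [wordMap_replicate_vert] using this
    rw [sierf_vert_comm] at h1
    refine hcell b (List.length_replicate (n := n) (a := a)) (by simpa using hv) a j ?_
    simpa only [wordMap_replicate_vert] using h1

/-- The set `Ak (n + 1)` meets every closed annulus of width `2⁻ⁿ` it does not lie on one side
of. -/
lemma exists_mem_Ak_dist_mem_Icc (n : ℕ) (x : EuclideanSpace ℝ (Fin 2)) {r R : ℝ}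
    (hrR : r + ((2 : ℝ) ^ n)⁻¹ ≤ R) {a b : EuclideanSpace ℝ (Fin 2)}
    (ha : a ∈ Ak (n + 1)) (hb : b ∈ Ak (n + 1)) (hax : dist a x ≤ R) (hbx : r ≤ dist b x) :
    ∃ y ∈ Ak (n + 1), dist y x ∈ Set.Icc r R := by
  by_contra! hcon
  have hcon' : ∀ (w : List (Fin 3)), w.length = n → ∀ i,
      dist (wordMap sierf w (vert i)) x < r ∨ R < dist (wordMap sierf w (vert i)) x := by
    rintro w rfl i
    have := hcon _ ⟨(w.get, i), rfl⟩
    simp only [List.ofFn_get, Set.mem_Icc, not_and_or, not_le] at this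
    exact this
  obtain ⟨⟨w, i⟩, rfl⟩ := ha
  obtain ⟨⟨v, j⟩, rfl⟩ := hb
  have := wordMap_vert_iff n (fun y => dist y x < r) (fun u hu i j h => by
    have h1 : dist (wordMap sierf u (vert j)) (wordMap sierf u (vert i)) ≤ ((2 : ℝ) ^ n)⁻¹ := by
      rw [dist_wordMap, hu]
      exact mul_le_of_le_one_right (by positivity) (dist_vert_le_one _ _)
    have h2 := dist_triangle (wordMap sierf u (vert j)) (wordMap sierf u (vert i)) x
    rcases hcon' u hu j with h3 | h3
    · exact h3
    · linarith) (w := List.ofFn w) (v := List.ofFn v) (by simp) (by simp) i j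
    ((hcon' _ (by simp) i).resolve_right (not_lt.2 hax))
  exact absurd this (not_lt.2 hbx)

lemma muK_succ_apply (n : ℕ) {E : Set (EuclideanSpace ℝ (Fin 2))} (hE : MeasurableSet E) :
    muK (n + 1) E = ((3 : ℝ≥0∞) ^ (n + 1))⁻¹ * ∑ w : Fin n → Fin 3, ∑ j : Fin 3,
      E.indicator 1 (wordMap sierf (List.ofFn w) (vert j)) := by
  simp [muK, hE]

section SelfSimilar

variable {μ : Measure (EuclideanSpace ℝ (Fin 2))}

lemma measure_eq_sum_preimage_sierf
    (hinv : μ = (3 : ℝ≥0∞)⁻¹ • (μ.map (sierf 0) + μ.map (sierf 1) + μ.map (sierf 2)))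
    {E : Set (EuclideanSpace ℝ (Fin 2))} (hE : MeasurableSet E) :
    μ E = 3⁻¹ * ∑ j : Fin 3, μ (sierf j ⁻¹' E) := by
  conv_lhs => rw [hinv]
  simp [Fin.sum_univ_three, Measure.map_apply (measurable_sierf _) hE, mul_add]

lemma measure_eq_sum_preimage_wordMap
    (hinv : μ = (3 : ℝ≥0∞)⁻¹ • (μ.map (sierf 0) + μ.map (sierf 1) + μ.map (sierf 2)))
    (n : ℕ) {E : Set (EuclideanSpace ℝ (Fin 2))} (hE : MeasurableSet E) :
    μ E = ((3 : ℝ≥0∞) ^ n)⁻¹ *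
      ∑ w : Fin n → Fin 3, μ (wordMap sierf (List.ofFn w) ⁻¹' E) := by
  induction n generalizing E with
  | zero => simp [wordMap]
  | succ n ih =>
    rw [measure_eq_sum_preimage_sierf hinv hE, ← (Fin.consEquiv fun _ => Fin 3).sum_comp,
      Fintype.sum_prod_type, pow_succ, ENNReal.mul_inv (by simp) (by simp), mul_comm _ 3⁻¹,
      mul_assoc, Finset.mul_sum (a := ((3 : ℝ≥0∞) ^ n)⁻¹)]
    congr 2 with j
    rw [ih (measurable_sierf j hE)]
    simp [Fin.consEquiv, wordMap, Set.preimage_comp]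

lemma measure_eq_sum_preimage_cell
    (hinv : μ = (3 : ℝ≥0∞)⁻¹ • (μ.map (sierf 0) + μ.map (sierf 1) + μ.map (sierf 2)))
    (n : ℕ) {E : Set (EuclideanSpace ℝ (Fin 2))} (hE : MeasurableSet E) :
    μ E = ((3 : ℝ≥0∞) ^ (n + 1))⁻¹ * ∑ w : Fin n → Fin 3, ∑ j : Fin 3,
      μ (sierf j ⁻¹' (wordMap sierf (List.ofFn w) ⁻¹' E)) := by
  rw [measure_eq_sum_preimage_wordMap hinv n hE, pow_succ, ENNReal.mul_inv (by simp) (by simp),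
    mul_assoc, Finset.mul_sum (a := 3⁻¹)]
  congr 2 with w
  exact measure_eq_sum_preimage_sierf hinv (measurable_wordMap _ hE)

variable {S : Set (EuclideanSpace ℝ (Fin 2))} [IsProbabilityMeasure μ]

lemma measure_le_muK (hsupp : μ Sᶜ = 0)
    (hinv : μ = (3 : ℝ≥0∞)⁻¹ • (μ.map (sierf 0) + μ.map (sierf 1) + μ.map (sierf 2)))
    (n : ℕ) {E F : Set (EuclideanSpace ℝ (Fin 2))} (hE : MeasurableSet E) (hF : MeasurableSet F)
    (h : ∀ (w : Fin n → Fin 3) (j : Fin 3), ∀ s ∈ S,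
      wordMap sierf (List.ofFn w) (sierf j s) ∈ E → wordMap sierf (List.ofFn w) (vert j) ∈ F) :
    μ E ≤ muK (n + 1) F := by
  rw [muK_succ_apply n hF, measure_eq_sum_preimage_cell hinv n hE]
  gcongr with w _ j _
  by_cases hj : wordMap sierf (List.ofFn w) (vert j) ∈ F
  · simpa [hj] using prob_le_one
  · exact (measure_mono_null (fun s hs hsS => hj (h w j s hsS hs)) hsupp).trans_le zero_le

lemma muK_le_measure (hsupp : μ Sᶜ = 0)
    (hinv : μ = (3 : ℝ≥0∞)⁻¹ • (μ.map (sierf 0) + μ.map (sierf 1) + μ.map (sierf 2)))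
    (n : ℕ) {E F : Set (EuclideanSpace ℝ (Fin 2))} (hE : MeasurableSet E) (hF : MeasurableSet F)
    (h : ∀ (w : Fin n → Fin 3) (j : Fin 3), ∀ s ∈ S,
      wordMap sierf (List.ofFn w) (vert j) ∈ F → wordMap sierf (List.ofFn w) (sierf j s) ∈ E) :
    muK (n + 1) F ≤ μ E := by
  rw [muK_succ_apply n hF, measure_eq_sum_preimage_cell hinv n hE]
  gcongr with w _ j _
  by_cases hj : wordMap sierf (List.ofFn w) (vert j) ∈ F
  · have hSj : S ⊆ sierf j ⁻¹' (wordMap sierf (List.ofFn w) ⁻¹' E) := fun s hs => h w j s hs hj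
    have hS : (1 : ℝ≥0∞) ≤ μ S := by
      have := measure_univ_le_add_compl (μ := μ) S
      simpa [hsupp] using this
    simpa [hj] using hS.trans (measure_mono hSj)
  · simp [hj]

end SelfSimilar

/-- for the Sierpinski gasket, if `2⁻ᵏ < d ≤ max_i ‖z_i − x‖` and
`B(x, d) ∩ A_k ≠ ∅`, then there are `y_k, z_k ∈ A_k` with
`d_{y_k}, d_{z_k} ∈ [d − 2⁻ᵏ, d + 2⁻ᵏ]` and
`μ_k(B̊(x, d_{y_k})) ≤ μ(B(x, d)) ≤ μ_k(B(x, d_{z_k}))`. -/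
theorem stmt19
    (S : Set (EuclideanSpace ℝ (Fin 2))) (hSc : IsCompact S) (hSne : S.Nonempty)
    (hSattr : S = ⋃ i, sierf i '' S)
    (μ : Measure (EuclideanSpace ℝ (Fin 2))) (hprob : IsProbabilityMeasure μ)
    (hsupp : μ Sᶜ = 0)
    (hinv : μ = (3 : ℝ≥0∞)⁻¹ • (μ.map (sierf 0) + μ.map (sierf 1) + μ.map (sierf 2)))
    (k : ℕ) (hk : 1 ≤ k) (x : EuclideanSpace ℝ (Fin 2)) (d : ℝ)
    (hd1 : ((2 : ℝ) ^ k)⁻¹ < d)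
    (hd2 : d ≤ max (dist (vert 0) x) (max (dist (vert 1) x) (dist (vert 2) x)))
    (hne : (Metric.closedBall x d ∩ Ak k).Nonempty) :
    ∃ yk ∈ Ak k, ∃ zk ∈ Ak k,
      dist yk x ∈ Set.Icc (d - ((2 : ℝ) ^ k)⁻¹) (d + ((2 : ℝ) ^ k)⁻¹) ∧
      dist zk x ∈ Set.Icc (d - ((2 : ℝ) ^ k)⁻¹) (d + ((2 : ℝ) ^ k)⁻¹) ∧
      muK k (Metric.ball x (dist yk x)) ≤ μ (Metric.closedBall x d) ∧
      μ (Metric.closedBall x d) ≤ muK k (Metric.closedBall x (dist zk x)) := by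
  obtain ⟨n, rfl⟩ : ∃ n, k = n + 1 := ⟨k - 1, by omega⟩
  have hfin : (Ak (n + 1)).Finite := Set.finite_range _
  set ε : ℝ := ((2 : ℝ) ^ (n + 1))⁻¹ with hε
  have hε2 : ((2 : ℝ) ^ n)⁻¹ = 2 * ε := by
    rw [hε, pow_succ]
    field_simp
  have hcell (w : Fin n → Fin 3) (j : Fin 3) (s) (hs : s ∈ S) :
      dist (wordMap sierf (List.ofFn w) (sierf j s)) (wordMap sierf (List.ofFn w) (vert j))
        ≤ ε := by
    have h1 := dist_vert_le_one_of_mem hSc hSattr hs j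
    have h2 := dist_sierf j s (vert j)
    rw [sierf_vert_self] at h2
    rw [dist_wordMap, h2, List.length_ofFn, hε2]
    have : 0 < ε := by positivity
    nlinarith
  obtain ⟨a, had, ha⟩ := hne
  obtain ⟨i, hi⟩ : ∃ i, d ≤ dist (vert i) x := by
    simp only [le_max_iff] at hd2
    rcases hd2 with h | h | h
    exacts [⟨0, h⟩, ⟨1, h⟩, ⟨2, h⟩]
  have hε0 : 0 < ε := by positivity
  obtain ⟨c, hc, hcd⟩ := exists_mem_Ak_dist_mem_Icc n x (r := d - ε) (R := d + ε)
    (by linarith) ha (vert_mem_Ak _ i) (by linarith [Metric.mem_closedBall.1 had]) (by linarith)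
  obtain ⟨y, ⟨hy, hyd⟩, hymin⟩ := Set.exists_min_image {y ∈ Ak (n + 1) | d - ε ≤ dist y x}
    (fun y => dist y x) (hfin.subset fun _ h => h.1) ⟨c, hc, hcd.1⟩
  obtain ⟨z, ⟨hz, hzd⟩, hzmax⟩ := Set.exists_max_image {z ∈ Ak (n + 1) | dist z x ≤ d + ε}
    (fun z => dist z x) (hfin.subset fun _ h => h.1) ⟨c, hc, hcd.2⟩
  refine ⟨y, hy, z, hz, ⟨hyd, (hymin c ⟨hc, hcd.1⟩).trans hcd.2⟩,
    ⟨hcd.1.trans (hzmax c ⟨hc, hcd.2⟩), hzd⟩, ?_, ?_⟩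
  · refine muK_le_measure hsupp hinv n measurableSet_closedBall measurableSet_ball ?_
    intro w j s hs hj
    have h1 : dist (wordMap sierf (List.ofFn w) (vert j)) x < d - ε := by
      by_contra! h
      exact (hymin _ ⟨⟨(w, j), rfl⟩, h⟩).not_gt hj
    have h2 := dist_triangle (wordMap sierf (List.ofFn w) (sierf j s))
      (wordMap sierf (List.ofFn w) (vert j)) x
    rw [Metric.mem_closedBall]
    linarith [hcell w j s hs]
  · refine measure_le_muK hsupp hinv n measurableSet_closedBall measurableSet_closedBall ?_
    intro w j s hs hj
    refine hzmax _ ⟨⟨(w, j), rfl⟩, ?_⟩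
    have h2 := dist_triangle_left (wordMap sierf (List.ofFn w) (vert j)) x
      (wordMap sierf (List.ofFn w) (sierf j s))
    linarith [hcell w j s hs, Metric.mem_closedBall.1 hj]
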